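/- Let X_1, X_2, X_3, X_4 be random variables taking finitely many values, and regard (X_3, X_4) as a single variable Z held by the third party. If the tripartite dependence of (X_1, X_2, Z) vanishes, i.e., min{ I(X_1 : X_2 | Z), I(X_1 : Z | X_2), I(X_2 : Z | X_1) } = 0, then after splitting the third party into two, the four-partite dependence vanishes as well: min over ordered pairs of distinct indices i ≠ j in {1,2,3,4} of I(X_i : X_j | (X_k)_{k∉{i,j}}) = 0. -/

import Mathlib

/-- Probability that the random variable `X` (on the finite sample space `Ω`
with probability mass function `p`) takes the value `s`. -/
noncomputable def pOf {Ω S : Type*} [Fintype Ω] [DecidableEq S]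
    (p : Ω → ℝ) (X : Ω → S) (s : S) : ℝ :=
  ∑ ω, if X ω = s then p ω else 0

/-- Shannon entropy (natural logarithm, `0 log 0 = 0`) of a random variable `X`. -/
noncomputable def ent {Ω S : Type*} [Fintype Ω] [Fintype S] [DecidableEq S]
    (p : Ω → ℝ) (X : Ω → S) : ℝ :=
  ∑ s, Real.negMulLog (pOf p X s)

/-- Mutual information `I(X : Y) = H(X) + H(Y) - H(X,Y)`. -/
noncomputable def mi {Ω S T : Type*} [Fintype Ω] [Fintype S] [DecidableEq S]
    [Fintype T] [DecidableEq T] (p : Ω → ℝ) (X : Ω → S) (Y : Ω → T) : ℝ :=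
  ent p X + ent p Y - ent p (fun ω => (X ω, Y ω))

/-- Conditional mutual information
`I(X : Y | Z) = H(X,Z) + H(Y,Z) - H(X,Y,Z) - H(Z)`. -/
noncomputable def cmi {Ω S T U : Type*} [Fintype Ω] [Fintype S] [DecidableEq S]
    [Fintype T] [DecidableEq T] [Fintype U] [DecidableEq U]
    (p : Ω → ℝ) (X : Ω → S) (Y : Ω → T) (Z : Ω → U) : ℝ :=
  ent p (fun ω => (X ω, Z ω)) + ent p (fun ω => (Y ω, Z ω))
    - ent p (fun ω => ((X ω, Y ω), Z ω)) - ent p Z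

/-- `N`-partite dependence (infimum over ordered pairs of distinct indices of the
conditional mutual information given all remaining parties). -/
noncomputable def depC {Ω : Type*} [Fintype Ω] {n : ℕ} {V : Fin n → Type*}
    [∀ i, Fintype (V i)] [∀ i, DecidableEq (V i)]
    (p : Ω → ℝ) (X : (i : Fin n) → Ω → V i) : ℝ :=
  sInf {x | ∃ i j : Fin n, i ≠ j ∧
    x = cmi p (X i) (X j) (fun ω => fun k : {k : Fin n // k ≠ i ∧ k ≠ j} => X k ω)}

theorem sum_pOf_mul {Ω S : Type*} [Fintype Ω] [Fintype S] [DecidableEq S]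
    (p : Ω → ℝ) (X : Ω → S) (g : S → ℝ) :
    ∑ s, pOf p X s * g s = ∑ ω, p ω * g (X ω) := by
  simp only [pOf, Finset.sum_mul]
  rw [Finset.sum_comm]
  refine Finset.sum_congr rfl fun ω _ => ?_
  simp [ite_mul]

theorem ent_eq_sum {Ω S : Type*} [Fintype Ω] [Fintype S] [DecidableEq S]
    (p : Ω → ℝ) (X : Ω → S) :
    ent p X = ∑ ω, p ω * (-Real.log (pOf p X (X ω))) := by
  rw [← sum_pOf_mul p X (fun s => -Real.log (pOf p X s))]
  simp [ent, Real.negMulLog]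

theorem ent_congr {Ω S T : Type*} [Fintype Ω] [Fintype S] [DecidableEq S]
    [Fintype T] [DecidableEq T] (p : Ω → ℝ) (X : Ω → S) (Y : Ω → T)
    (h : ∀ a b, X a = X b ↔ Y a = Y b) : ent p X = ent p Y := by
  rw [ent_eq_sum, ent_eq_sum]
  simp [pOf, h]

theorem pOf_nonneg {Ω S : Type*} [Fintype Ω] [DecidableEq S]
    (p : Ω → ℝ) (hp : ∀ ω, 0 ≤ p ω) (X : Ω → S) (s : S) : 0 ≤ pOf p X s := by
  unfold pOf
  refine Finset.sum_nonneg fun ω _ => ?_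
  split_ifs
  · exact hp ω
  · exact le_rfl

theorem pOf_pos {Ω S : Type*} [Fintype Ω] [DecidableEq S]
    (p : Ω → ℝ) (hp : ∀ ω, 0 ≤ p ω) (X : Ω → S) (ω : Ω) (h : 0 < p ω) :
    0 < pOf p X (X ω) := by
  unfold pOf
  refine Finset.sum_pos' (fun a _ => ?_) ⟨ω, Finset.mem_univ _, by simpa using h⟩
  split_ifs
  · exact hp a
  · exact le_rfl

theorem sum_pOf_pair {Ω S U : Type*} [Fintype Ω] [Fintype S] [DecidableEq S]
    [DecidableEq U] (p : Ω → ℝ) (X : Ω → S) (Z : Ω → U) (z : U) :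
    ∑ x, pOf p (fun ω => (X ω, Z ω)) (x, z) = pOf p Z z := by
  unfold pOf
  rw [Finset.sum_comm]
  refine Finset.sum_congr rfl fun ω _ => ?_
  by_cases h : Z ω = z <;> simp [h]

theorem cmi_nonneg {Ω S T U : Type*} [Fintype Ω] [Fintype S] [DecidableEq S]
    [Fintype T] [DecidableEq T] [Fintype U] [DecidableEq U]
    (p : Ω → ℝ) (hp : ∀ ω, 0 ≤ p ω)
    (X : Ω → S) (Y : Ω → T) (Z : Ω → U) : 0 ≤ cmi p X Y Z := by
  set A := pOf p (fun ω => (X ω, Z ω)) with hA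
  set B := pOf p (fun ω => (Y ω, Z ω)) with hB
  set C := pOf p (fun ω => ((X ω, Y ω), Z ω)) with hC
  set D := pOf p Z with hD
  have hA0 : ∀ s, 0 ≤ A s := pOf_nonneg p hp _
  have hB0 : ∀ s, 0 ≤ B s := pOf_nonneg p hp _
  have hC0 : ∀ s, 0 ≤ C s := pOf_nonneg p hp _
  have hD0 : ∀ s, 0 ≤ D s := pOf_nonneg p hp _
  let g : (S × T) × U → ℝ := fun s => A (s.1.1, s.2) * B (s.1.2, s.2) / (C s * D s.2)
  have hsum : ∑ ω, p ω * g ((X ω, Y ω), Z ω) ≤ ∑ ω, p ω := by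
    rw [← sum_pOf_mul p (fun ω => ((X ω, Y ω), Z ω)) g]
    have e1 : ∑ ω, p ω = ∑ z, D z := by
      have := sum_pOf_mul p Z (fun _ => 1)
      simpa using this.symm
    rw [e1]
    calc ∑ s, C s * g s ≤ ∑ s : (S × T) × U, A (s.1.1, s.2) * B (s.1.2, s.2) / D s.2 := by
          refine Finset.sum_le_sum fun s _ => ?_
          rcases (hC0 s).eq_or_lt with h | h
          · rw [← h, zero_mul]
            exact div_nonneg (mul_nonneg (hA0 _) (hB0 _)) (hD0 _)
          · apply le_of_eq
            simp only [g]
            rw [mul_div_assoc', mul_div_mul_left _ _ h.ne']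
      _ = ∑ z, ∑ x, ∑ y, A (x, z) * B (y, z) / D z := by
          rw [Fintype.sum_prod_type_right]
          refine Finset.sum_congr rfl fun z _ => ?_
          rw [Fintype.sum_prod_type]
      _ = ∑ z, D z * D z / D z := by
          refine Finset.sum_congr rfl fun z _ => ?_
          simp only [← Finset.sum_div, ← Finset.mul_sum, ← Finset.sum_mul]
          rw [hA, hB, sum_pOf_pair, sum_pOf_pair]
      _ ≤ ∑ z, D z := by
          refine Finset.sum_le_sum fun z _ => ?_
          rw [mul_self_div_self]
  have hcmi : cmi p X Y Z = ∑ ω, p ω * (-Real.log (A (X ω, Z ω)) - Real.log (B (Y ω, Z ω))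
      + Real.log (C ((X ω, Y ω), Z ω)) + Real.log (D (Z ω))) := by
    unfold cmi
    rw [ent_eq_sum, ent_eq_sum, ent_eq_sum, ent_eq_sum, ← Finset.sum_add_distrib,
      ← Finset.sum_sub_distrib, ← Finset.sum_sub_distrib]
    refine Finset.sum_congr rfl fun ω _ => ?_
    ring
  have key : ∑ ω, (p ω - p ω * g ((X ω, Y ω), Z ω)) ≤ cmi p X Y Z := by
    rw [hcmi]
    refine Finset.sum_le_sum fun ω _ => ?_
    rcases (hp ω).eq_or_lt with h | h
    · simp [← h]
    have a := pOf_pos p hp (fun ω => (X ω, Z ω)) ω h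
    have b := pOf_pos p hp (fun ω => (Y ω, Z ω)) ω h
    have c := pOf_pos p hp (fun ω => ((X ω, Y ω), Z ω)) ω h
    have d := pOf_pos p hp Z ω h
    rw [← hA] at a
    rw [← hB] at b
    rw [← hC] at c
    rw [← hD] at d
    have hl := Real.log_le_sub_one_of_pos
      (show 0 < g ((X ω, Y ω), Z ω) by simp only [g]; positivity)
    have : Real.log (g ((X ω, Y ω), Z ω)) = Real.log (A (X ω, Z ω)) + Real.log (B (Y ω, Z ω))
      - (Real.log (C ((X ω, Y ω), Z ω)) + Real.log (D (Z ω))) := by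
      simp only [g]
      rw [Real.log_div (by positivity) (by positivity), Real.log_mul a.ne' b.ne',
        Real.log_mul c.ne' d.ne']
    nlinarith [mul_le_mul_of_nonneg_left hl h.le]
  rw [Finset.sum_sub_distrib] at key
  linarith

theorem cmi_chain {Ω S T T' U : Type*} [Fintype Ω] [Fintype S] [DecidableEq S]
    [Fintype T] [DecidableEq T] [Fintype T'] [DecidableEq T'] [Fintype U] [DecidableEq U]
    (p : Ω → ℝ) (X : Ω → S) (Y : Ω → T) (W : Ω → T') (Z : Ω → U) :
    cmi p X (fun ω => (Y ω, W ω)) Z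
      = cmi p X Y Z + cmi p X W (fun ω => (Z ω, Y ω)) := by
  unfold cmi
  rw [ent_congr p (fun ω => ((Y ω, W ω), Z ω)) (fun ω => (W ω, Z ω, Y ω)) (by simp; tauto),
    ent_congr p (fun ω => ((X ω, Y ω, W ω), Z ω)) (fun ω => ((X ω, W ω), Z ω, Y ω))
      (by simp; tauto),
    ent_congr p (fun ω => ((X ω, Y ω), Z ω)) (fun ω => (X ω, Z ω, Y ω)) (by simp; tauto),
    ent_congr p (fun ω => (Y ω, Z ω)) (fun ω => (Z ω, Y ω)) (by simp; tauto)]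
  ring

theorem cmi_congr {Ω S T U U' : Type*} [Fintype Ω] [Fintype S] [DecidableEq S]
    [Fintype T] [DecidableEq T] [Fintype U] [DecidableEq U] [Fintype U'] [DecidableEq U']
    (p : Ω → ℝ) (X : Ω → S) (Y : Ω → T) (Z : Ω → U) (Z' : Ω → U')
    (h : ∀ a b, Z a = Z b ↔ Z' a = Z' b) : cmi p X Y Z = cmi p X Y Z' := by
  unfold cmi
  rw [ent_congr p (fun ω => (X ω, Z ω)) (fun ω => (X ω, Z' ω)) (by simp [h]),
    ent_congr p (fun ω => (Y ω, Z ω)) (fun ω => (Y ω, Z' ω)) (by simp [h]),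
    ent_congr p (fun ω => ((X ω, Y ω), Z ω)) (fun ω => ((X ω, Y ω), Z' ω)) (by simp [h]),
    ent_congr p Z Z' h]

/-- if the third party of a tripartite system holds the pair
`Z = (X_3, X_4)` and the tripartite dependence of `(X_1, X_2, Z)` vanishes, then
after splitting the third party into two, the four-partite dependence of
`(X_1, X_2, X_3, X_4)` vanishes as well. -/
theorem stmt_5 {Ω : Type*} [Fintype Ω] {V : Fin 4 → Type*}
    [∀ i, Fintype (V i)] [∀ i, DecidableEq (V i)]
    (p : Ω → ℝ) (hp : ∀ ω, 0 ≤ p ω) (hp1 : ∑ ω, p ω = 1)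
    (X : (i : Fin 4) → Ω → V i)
    (h3 : min (min
        (cmi p (X 0) (X 1) (fun ω => (X 2 ω, X 3 ω)))
        (cmi p (X 0) (fun ω => (X 2 ω, X 3 ω)) (X 1)))
        (cmi p (X 1) (fun ω => (X 2 ω, X 3 ω)) (X 0)) = 0) :
    depC p X = 0 := by
  apply IsLeast.csInf_eq
  constructor
  swap
  · rintro x ⟨i, j, _, rfl⟩
    exact cmi_nonneg p hp _ _ _
  have hc : cmi p (X 0) (X 1) (fun ω => (X 2 ω, X 3 ω)) = 0 ∨
      cmi p (X 0) (fun ω => (X 2 ω, X 3 ω)) (X 1) = 0 ∨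
      cmi p (X 1) (fun ω => (X 2 ω, X 3 ω)) (X 0) = 0 := by
    rcases min_choice (min (cmi p (X 0) (X 1) (fun ω => (X 2 ω, X 3 ω)))
        (cmi p (X 0) (fun ω => (X 2 ω, X 3 ω)) (X 1)))
        (cmi p (X 1) (fun ω => (X 2 ω, X 3 ω)) (X 0)) with h | h
    · rcases min_choice (cmi p (X 0) (X 1) (fun ω => (X 2 ω, X 3 ω)))
        (cmi p (X 0) (fun ω => (X 2 ω, X 3 ω)) (X 1)) with h' | h'
      · left; rw [← h', ← h, h3]
      · right; left; rw [← h', ← h, h3]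
    · right; right; rw [← h, h3]
  rcases hc with h | h | h
  · refine ⟨0, 1, by decide, ?_⟩
    rw [← h]
    apply cmi_congr
    intro a b
    simp [funext_iff, Fin.forall_fin_succ]
  · refine ⟨0, 3, by decide, ?_⟩
    rw [cmi_chain] at h
    have h1 := cmi_nonneg p hp (X 0) (X 2) (X 1)
    have h2 := cmi_nonneg p hp (X 0) (X 3) (fun ω => (X 1 ω, X 2 ω))
    trans cmi p (X 0) (X 3) (fun ω => (X 1 ω, X 2 ω))
    · linarith
    apply cmi_congr
    intro a b
    simp [funext_iff, Fin.forall_fin_succ]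
  · refine ⟨1, 3, by decide, ?_⟩
    rw [cmi_chain] at h
    have h1 := cmi_nonneg p hp (X 1) (X 2) (X 0)
    have h2 := cmi_nonneg p hp (X 1) (X 3) (fun ω => (X 0 ω, X 2 ω))
    trans cmi p (X 1) (X 3) (fun ω => (X 0 ω, X 2 ω))
    · linarith
    apply cmi_congr
    intro a b
    simp [funext_iff, Fin.forall_fin_succ]
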